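/- arXiv:2108.12005 — 2 statements merged into one kernel-verified Lean document; each statement's English description precedes it below -/
import Mathlib

section
/- Let A be an abelian category with enough injectives. Then for each pair of objects K, L of the bounded derived category D^b(A) there is a decreasing filtration F on Hom_{D(A)}(K, L), natural in K and L (arising from a functor D^b(A)^op × D^b(A) → FAb lifting the Hom-functor to filtered abelian groups), satisfying: (1) F^0 Hom(K,L) = Hom(K,L) and F^p Hom(K,L) = 0 for p sufficiently large; (2) if f ∈ F^p Hom(K,L) and g ∈ F^q Hom(L,M) then g∘f ∈ F^{p+q} Hom(K,M); (3) F^p Hom(K,L)/F^{p+1} Hom(K,L) is a subquotient of ∏_{n ∈ ℤ} Ext^p_A(H^n(K), H^{n−p}(L)); (4) F^1 Hom(K,L) = {φ ∈ Hom_{D(A)}(K,L) : H^n(φ) = 0 for all n ∈ ℤ}. -/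
open CategoryTheory Limits

section ObstructionFiltration

open CategoryTheory Limits

universe w v' u'

variable (A : Type u') [Category.{v'} A] [Abelian A] [HasDerivedCategory.{w} A]

/-- An object of the derived category is (cohomologically) bounded. -/
def isBddD (K : DerivedCategory A) : Prop :=
  ∃ a b : ℤ, ∀ n : ℤ, (n < a ∨ b < n) →
    IsZero ((DerivedCategory.homologyFunctor A n).obj K)

/-- `S` is (isomorphic to) a subquotient of `B`: some subgroup of `B` surjects onto `S`. -/
def IsAddSubquotient (B S : Type*) [AddCommGroup B] [AddCommGroup S] : Prop :=
  ∃ (B' : AddSubgroup B) (π : B' →+ S), Function.Surjective π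

/-- The `p`-th graded piece `F p / F (p+1)` of a decreasing filtration by subgroups. -/
abbrev filtGradedPiece {G : Type*} [AddCommGroup G] (F : ℕ → AddSubgroup G) (p : ℕ) :=
  F p ⧸ (F (p + 1)).addSubgroupOf (F p)

/-- The product `∏ₙ Ext^p(Hⁿ(K), H^{n-p}(L))` of Ext-groups of cohomology objects,
where `Ext^p(M, N) = Hom_{D(A)}(M, N[p])`. -/
abbrev extProdGrp (K L : DerivedCategory A) (p : ℕ) :=
  ∀ n : ℤ, ((DerivedCategory.singleFunctor A 0).obj
      ((DerivedCategory.homologyFunctor A n).obj K) ⟶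
    ((DerivedCategory.singleFunctor A 0).obj
      ((DerivedCategory.homologyFunctor A (n - p)).obj L))⟦(p : ℤ)⟧)

/-- The axioms for the obstruction-theoretic filtration on the Hom-groups of the bounded
derived category `D^b(A) ⊆ D(A)`:
(0) naturality (the filtration is compatible with pre- and post-composition, i.e. the
filtered Hom groups form a functor `D^b(A)ᵒᵖ × D^b(A) ⥤ FAb` lifting `Hom`);
(1) `F⁰ = Hom` and `F^p = 0` for `p ≫ 0` (the filtration is decreasing);
(2) multiplicativity: composition maps `F^p × F^q` into `F^{p+q}`;
(3) `F^p/F^{p+1}` is a subquotient of `∏ₙ Ext^p(Hⁿ(K), H^{n-p}(L))`;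
(4) `F¹` consists exactly of the morphisms vanishing on all cohomology objects. -/
def IsObstructionFiltration
    (F : ∀ (K L : DerivedCategory A), ℕ → AddSubgroup (K ⟶ L)) : Prop :=
  (∀ (K' K L L' : DerivedCategory A), isBddD A K' → isBddD A K → isBddD A L →
      isBddD A L' → ∀ (u : K' ⟶ K) (v : L ⟶ L') (p : ℕ) (f : K ⟶ L),
        f ∈ F K L p → u ≫ f ≫ v ∈ F K' L' p) ∧
  (∀ K L : DerivedCategory A, isBddD A K → isBddD A L →
      (∀ p, F K L (p + 1) ≤ F K L p) ∧ F K L 0 = ⊤ ∧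
      ∃ p₀, ∀ p, p₀ ≤ p → F K L p = ⊥) ∧
  (∀ K L M : DerivedCategory A, isBddD A K → isBddD A L → isBddD A M →
      ∀ (p q : ℕ) (f : K ⟶ L) (g : L ⟶ M),
        f ∈ F K L p → g ∈ F L M q → f ≫ g ∈ F K M (p + q)) ∧
  (∀ K L : DerivedCategory A, isBddD A K → isBddD A L → ∀ p : ℕ,
      IsAddSubquotient (extProdGrp A K L p) (filtGradedPiece (F K L) p)) ∧
  (∀ K L : DerivedCategory A, isBddD A K → isBddD A L → ∀ f : K ⟶ L,
      (f ∈ F K L 1 ↔ ∀ n : ℤ, (DerivedCategory.homologyFunctor A n).map f = 0))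

end ObstructionFiltration


namespace ObsFil

open CategoryTheory Limits

universe w v' u'

section Complexes

variable {A : Type u'} [Category.{v'} A] [Abelian A]

open HomologicalComplex

/-- Realizing maps on homology by maps into a zero-differential complex of injectives. -/
lemma exists_complex_hom (K J : CochainComplex A ℤ) (hJ : ∀ i j, J.d i j = 0)
    [∀ n, Injective (J.X n)] (φ : ∀ n, K.homology n ⟶ J.homology n) :
    ∃ f : K ⟶ J, ∀ n, homologyMap f n = φ n := by
  have hp : ∀ n, IsIso (J.pOpcycles n) := fun n =>
    J.isIso_pOpcycles (n - 1) n (by simp) (hJ _ _)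
  let g : ∀ n, K.opcycles n ⟶ J.X n := fun n =>
    Injective.factorThru (φ n ≫ J.homologyι n ≫ inv (J.pOpcycles n)) (K.homologyι n)
  have hg : ∀ n, K.homologyι n ≫ g n = φ n ≫ J.homologyι n ≫ inv (J.pOpcycles n) := fun n =>
    Injective.comp_factorThru _ _
  refine ⟨{ f := fun n => K.pOpcycles n ≫ g n, comm' := ?_ }, ?_⟩
  · intro i j _
    simp [hJ]
  · intro n
    rw [← cancel_mono (J.homologyι n)]
    simp only [homologyι_naturality]
    have : ∀ (f : K ⟶ J), f.f n = K.pOpcycles n ≫ g n →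
        opcyclesMap f n = g n ≫ J.pOpcycles n := by
      intro f hf
      rw [← cancel_epi (K.pOpcycles n)]
      simp [hf]
    rw [this _ rfl, reassoc_of% hg n]
    simp

lemma nonempty_homotopy (K J : CochainComplex A ℤ) (hJ : ∀ i j, J.d i j = 0)
    [∀ n, Injective (J.X n)] (f : K ⟶ J) (hf : ∀ n, homologyMap f n = 0) :
    Nonempty (Homotopy f 0) := by
  have h1 : ∀ n, K.iCycles n ≫ f.f n = 0 := by
    intro n
    have : IsIso (J.homologyπ n) := J.isIso_homologyπ (n - 1) n (by simp) (hJ _ _)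
    have h2 : cyclesMap f n = 0 := by
      rw [← cancel_mono (J.homologyπ n), ← homologyπ_naturality, hf]
      simp
    rw [← cyclesMap_i, h2, zero_comp]
  have h3 : ∀ i j : ℤ, j + 1 = i → ∃ s : K.X i ⟶ J.X j, K.d j i ≫ s = f.f j := by
    intro i j hij
    let S := ShortComplex.mk (K.iCycles j) (K.d j i) (K.iCycles_d j i)
    have hS : S.Exact := S.exact_of_f_is_kernel (K.cyclesIsKernel j i (by simp [hij]))
    exact ⟨hS.descToInjective (f.f j) (h1 j), hS.comp_descToInjective _ _⟩
  choose s hs using h3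
  exact ⟨{
    hom := fun i j => if h : j + 1 = i then s i j h else 0
    zero := fun i j h => dif_neg h
    comm := fun i => by
      rw [dNext_eq _ (show (ComplexShape.up ℤ).Rel i (i + 1) by simp),
        prevD_eq _ (show (ComplexShape.up ℤ).Rel (i - 1) i by simp)]
      simp [hJ, hs] }⟩

end Complexes

section Derived

variable {A : Type u'} [Category.{v'} A] [Abelian A] [HasDerivedCategory.{w} A]

open DerivedCategory

lemma exists_derived_hom (K : DerivedCategory A) (J : CochainComplex A ℤ)
    (hJ : ∀ i j, J.d i j = 0) [∀ n, Injective (J.X n)]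
    (φ : ∀ n, (homologyFunctor A n).obj K ⟶ (homologyFunctor A n).obj (Q.obj J)) :
    ∃ f : K ⟶ Q.obj J, ∀ n, (homologyFunctor A n).map f = φ n := by
  let e := Q.objObjPreimageIso K
  obtain ⟨f, hf⟩ := exists_complex_hom (Q.objPreimage K) J hJ (fun n =>
    (homologyFunctorFactors A n).inv.app _ ≫ (homologyFunctor A n).map e.hom ≫ φ n ≫
      (homologyFunctorFactors A n).hom.app J)
  refine ⟨e.inv ≫ Q.map f, fun n => ?_⟩
  rw [← cancel_mono ((homologyFunctorFactors A n).hom.app J), Functor.map_comp, Category.assoc,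
    homologyFunctorFactors_hom_naturality, hf]
  erw [Iso.hom_inv_id_app_assoc]
  simp
  rfl

lemma derived_hom_eq_zero (K : DerivedCategory A) (J : CochainComplex A ℤ)
    (hJ : ∀ i j, J.d i j = 0) [∀ n, Injective (J.X n)] [J.IsKInjective]
    (f : K ⟶ Q.obj J) (hf : ∀ n, (homologyFunctor A n).map f = 0) : f = 0 := by
  let e := Q.objObjPreimageIso K
  obtain ⟨g, hg⟩ : ∃ g : Q.objPreimage K ⟶ J, Q.map g = e.hom ≫ f := by
    obtain ⟨g, hg⟩ := (CochainComplex.IsKInjective.Qh_map_bijective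
      ((HomotopyCategory.quotient _ _).obj (Q.objPreimage K)) J).2
      ((quotientCompQhIso A).hom.app _ ≫ e.hom ≫ f ≫ (quotientCompQhIso A).inv.app _)
    obtain ⟨g, rfl⟩ := (HomotopyCategory.quotient _ _).map_surjective g
    refine ⟨g, ?_⟩
    rw [← cancel_epi ((quotientCompQhIso A).hom.app _), ← quotientCompQhIso_hom_naturality, hg]
    simp
  have h0 : ∀ n, HomologicalComplex.homologyMap g n = 0 := by
    intro n
    have h := homologyFunctorFactors_hom_naturality g n
    rw [hg, Functor.map_comp, hf, comp_zero, zero_comp] at h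
    exact (cancel_epi ((homologyFunctorFactors A n).hom.app _)).1 (h.symm.trans comp_zero.symm)
  obtain ⟨h⟩ := nonempty_homotopy _ J hJ g h0
  have : Q.map g = 0 := by
    rw [← cancel_epi ((quotientCompQhIso A).hom.app _), ← quotientCompQhIso_hom_naturality,
      HomotopyCategory.eq_of_homotopy _ _ h]
    simp
  rw [← cancel_epi e.hom, ← hg, this, comp_zero]

/-- The bounded-below resolution step. -/
lemma exists_resolution [EnoughInjectives A] (L : DerivedCategory A) (c : ℤ) (hL : L.IsGE c) :
    ∃ (J : DerivedCategory A) (j : L ⟶ J), J.IsGE c ∧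
      (∀ n, Mono ((homologyFunctor A n).map j)) ∧
      (∀ n, Injective ((homologyFunctor A n).obj J)) ∧
      (∀ (K : DerivedCategory A)
        (φ : ∀ n, (homologyFunctor A n).obj K ⟶ (homologyFunctor A n).obj J),
        ∃ f : K ⟶ J, ∀ n, (homologyFunctor A n).map f = φ n) ∧
      (∀ (K : DerivedCategory A) (f : K ⟶ J),
        (∀ n, (homologyFunctor A n).map f = 0) → f = 0) := by
  have h1 : ∀ n : ℤ, ∃ (I : A) (i : (homologyFunctor A n).obj L ⟶ I),
      Injective I ∧ Mono i ∧ (n < c → IsZero I) := by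
    intro n
    by_cases hn : n < c
    · refine ⟨(homologyFunctor A n).obj L, 𝟙 _, ?_, inferInstance, fun _ => isZero_of_isGE L c n hn⟩
      exact Injective.of_iso (isZero_of_isGE L c n hn).isoZero.symm inferInstance
    · exact ⟨Injective.under _, Injective.ι _, inferInstance, inferInstance, fun h => (hn h).elim⟩
  choose I i hI hi hz using h1
  let J : CochainComplex A ℤ := { X := I, d := fun _ _ => 0 }
  have hJ : ∀ i j, J.d i j = 0 := fun _ _ => rfl
  have hinj : ∀ n, Injective (J.X n) := hI
  have hge : J.IsStrictlyGE c := by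
    rw [CochainComplex.isStrictlyGE_iff]
    exact fun n hn => hz n hn
  have := CochainComplex.isKInjective_of_injective J c
  have hp : ∀ n, IsIso (J.pOpcycles n) := fun n =>
    J.isIso_pOpcycles (n - 1) n (by simp) (hJ _ _)
  have hq : ∀ n, IsIso (J.homologyι n) := fun n =>
    J.isIso_homologyι n (n + 1) (by simp) (hJ _ _)
  let e : ∀ n, (homologyFunctor A n).obj (Q.obj J) ≅ I n := fun n =>
    (homologyFunctorFactors A n).app J ≪≫ (@asIso _ _ _ _ _ (hq n)) ≪≫ (asIso (J.pOpcycles n)).symm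
  obtain ⟨j, hj⟩ := exists_derived_hom L J hJ (fun n => i n ≫ (e n).inv)
  refine ⟨Q.obj J, j, inferInstance, ?_, ?_, fun K => exists_derived_hom K J hJ,
    fun K => derived_hom_eq_zero K J hJ⟩
  · intro n
    rw [hj]
    infer_instance
  · intro n
    exact Injective.of_iso (e n).symm (hI n)

end Derived

section Filtration

variable {A : Type u'} [Category.{v'} A] [Abelian A] [HasDerivedCategory.{w} A]

open DerivedCategory Pretriangulated Abelian

/-- Ghost maps: those vanishing on all cohomology objects. -/
def Ghost {K L : DerivedCategory A} (f : K ⟶ L) : Prop :=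
  ∀ n : ℤ, (homologyFunctor A n).map f = 0

/-- Filtration by composites of ghost maps through bounded below objects. -/
noncomputable def Fil (K : DerivedCategory A) : ℕ → ∀ L : DerivedCategory A, AddSubgroup (K ⟶ L)
  | 0, _ => ⊤
  | p + 1, L => AddSubgroup.closure {f | ∃ (X : DerivedCategory A) (c : ℤ) (_ : X.IsGE c)
      (g : K ⟶ X) (h : X ⟶ L), g ∈ Fil K p X ∧ Ghost h ∧ f = g ≫ h}

lemma Ghost.comp {K L M : DerivedCategory A} {f : K ⟶ L} (hf : Ghost f) (g : L ⟶ M) :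
    Ghost (f ≫ g) := fun n => by rw [Functor.map_comp, hf n, zero_comp]

lemma Fil.comp_ghost {K X L : DerivedCategory A} {c : ℤ} (hX : X.IsGE c) {p : ℕ}
    {g : K ⟶ X} {h : X ⟶ L} (hg : g ∈ Fil K p X) (hh : Ghost h) : g ≫ h ∈ Fil K (p + 1) L :=
  AddSubgroup.subset_closure ⟨X, c, hX, g, h, hg, hh, rfl⟩

/-- Induction principle for the successor step. -/
lemma Fil.succ_le {K L : DerivedCategory A} {p : ℕ} (S : AddSubgroup (K ⟶ L))
    (H : ∀ (X : DerivedCategory A) (c : ℤ), X.IsGE c → ∀ (g : K ⟶ X) (h : X ⟶ L),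
      g ∈ Fil K p X → Ghost h → g ≫ h ∈ S) : Fil K (p + 1) L ≤ S := by
  rw [Fil, AddSubgroup.closure_le]
  rintro _ ⟨X, c, hX, g, h, hg, hh, rfl⟩
  exact H X c hX g h hg hh

lemma Fil.comp_right {K L M : DerivedCategory A} {p : ℕ} {f : K ⟶ L} (hf : f ∈ Fil K p L)
    (v : L ⟶ M) : f ≫ v ∈ Fil K p M := by
  cases p with
  | zero => simp [Fil]
  | succ p =>
    refine Fil.succ_le ((Fil K (p + 1) M).comap (Preadditive.rightComp K v)) ?_ hf
    intro X c hX g h hg hh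
    change (g ≫ h) ≫ v ∈ Fil K (p + 1) M
    rw [Category.assoc]
    exact Fil.comp_ghost hX hg (hh.comp v)

lemma Fil.comp_left {K' K : DerivedCategory A} (u : K' ⟶ K) {p : ℕ} :
    ∀ {L : DerivedCategory A} {f : K ⟶ L}, f ∈ Fil K p L → u ≫ f ∈ Fil K' p L := by
  induction p with
  | zero => intros; simp [Fil]
  | succ p ih =>
    intro L f hf
    refine Fil.succ_le ((Fil K' (p + 1) L).comap (Preadditive.leftComp L u)) ?_ hf
    intro X c hX g h hg hh
    change u ≫ g ≫ h ∈ Fil K' (p + 1) L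
    rw [← Category.assoc]
    exact Fil.comp_ghost hX (ih hg) hh

lemma Fil.anti (K L : DerivedCategory A) (p : ℕ) : Fil K (p + 1) L ≤ Fil K p L :=
  Fil.succ_le _ fun _ _ _ _ h hg _ => Fil.comp_right hg h

lemma Fil.mul {K L : DerivedCategory A} {p q : ℕ} {f : K ⟶ L} (hf : f ∈ Fil K p L) :
    ∀ {M : DerivedCategory A} {g : L ⟶ M}, g ∈ Fil L q M → f ≫ g ∈ Fil K (p + q) M := by
  induction q with
  | zero => exact fun _ => Fil.comp_right hf _
  | succ q ih =>
    intro M g hg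
    refine Fil.succ_le ((Fil K (p + (q + 1)) M).comap (Preadditive.leftComp M f)) ?_ hg
    intro X c hX g h hg hh
    change f ≫ g ≫ h ∈ Fil K (p + (q + 1)) M
    rw [← Category.assoc]
    exact Fil.comp_ghost hX (ih hg) hh

lemma Fil.ghost_of_mem {K L : DerivedCategory A} {f : K ⟶ L} (hf : f ∈ Fil K 1 L) : Ghost f := by
  intro n
  refine Fil.succ_le (p := 0) ((homologyFunctor A n).mapAddHom.ker) ?_ hf
  intro X c hX g h hg hh
  change (homologyFunctor A n).map (g ≫ h) = 0
  rw [Functor.map_comp, hh n, comp_zero]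

lemma Fil.mem_of_ghost {K L : DerivedCategory A} {c : ℤ} (hK : K.IsGE c) {f : K ⟶ L}
    (hf : Ghost f) : f ∈ Fil K 1 L := by
  have := Fil.comp_ghost (K := K) (p := 0) (g := 𝟙 K) hK (by simp [Fil]) hf
  simpa using this

/-- One step of the injective tower over `L`. -/
structure Step (T : Triangle (DerivedCategory A)) (c : ℤ) : Prop where
  dist : T ∈ distTriang _
  ge : T.obj₁.IsGE (c + 1)
  ghost : Ghost T.mor₁
  mono : ∀ n, Mono ((homologyFunctor A n).map T.mor₂)
  inj : ∀ n, Injective ((homologyFunctor A n).obj T.obj₃)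
  ex : ∀ (K : DerivedCategory A)
        (φ : ∀ n, (homologyFunctor A n).obj K ⟶ (homologyFunctor A n).obj T.obj₃),
        ∃ f : K ⟶ T.obj₃, ∀ n, (homologyFunctor A n).map f = φ n
  uniq : ∀ (K : DerivedCategory A) (f : K ⟶ T.obj₃), Ghost f → f = 0

lemma exists_step [EnoughInjectives A] (L : DerivedCategory A) (c : ℤ) (hL : L.IsGE c) :
    ∃ T : Triangle (DerivedCategory A), T.obj₂ = L ∧ Step T c := by
  obtain ⟨J, j, hJ, hm, hi, hex, huniq⟩ := exists_resolution L c hL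
  obtain ⟨L1, ι, δ', hT⟩ := distinguished_cocone_triangle₁ j
  have hg : Ghost ι := fun n => (HomologySequence.mono_homologyMap_mor₂_iff _ hT n).1 (hm n)
  refine ⟨_, rfl, ⟨hT, ?_, hg, hm, hi, hex, huniq⟩⟩
  rw [isGE_iff]
  intro i hi
  refine (HomologySequence.exact₁ _ hT (i - 1) i (by lia)).isZero_of_both_zeros ?_ (hg i)
  exact (isZero_of_isGE J c (i - 1) (by lia)).eq_of_src _ _

variable {T : Triangle (DerivedCategory A)} {c : ℤ}

lemma Step.fil_succ (S : Step T c) (K : DerivedCategory A) (p : ℕ) {f : K ⟶ T.obj₂}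
    (hf : f ∈ Fil K (p + 1) T.obj₂) : ∃ g ∈ Fil K p T.obj₁, g ≫ T.mor₁ = f := by
  refine Fil.succ_le ((Fil K p T.obj₁).map (Preadditive.rightComp K T.mor₁)) ?_ hf
  intro X c' hX g h hg hh
  obtain ⟨h', rfl⟩ := Triangle.coyoneda_exact₂ _ S.dist h (S.uniq _ _ (hh.comp _))
  exact ⟨g ≫ h', Fil.comp_right hg h', by simp [Preadditive.rightComp]⟩

/-- The short exact sequence `0 → Hᵐ(L) → Hᵐ(J) → Hᵐ⁺¹(L₁) → 0`. -/
noncomputable def Step.ses (S : Step T c) (m : ℤ) : ShortComplex A :=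
  ShortComplex.mk _ _ (HomologySequence.comp_δ T S.dist m (m + 1) rfl)

lemma Step.ses_shortExact (S : Step T c) (m : ℤ) : (ses S m).ShortExact where
  exact := HomologySequence.exact₃ T S.dist m (m + 1) rfl
  mono_f := S.mono m
  epi_g := (HomologySequence.exact₁ T S.dist m (m + 1) rfl).epi_f (S.ghost _)

lemma Fil.eq_bot [EnoughInjectives A] (K : DerivedCategory A) (b : ℤ) (hK : K.IsLE b) (p : ℕ) :
    ∀ (L : DerivedCategory A) (c : ℤ), L.IsGE c → b < c + p → Fil K p L = ⊥ := by
  induction p with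
  | zero =>
    intro L c hL h
    rw [eq_bot_iff]
    intro f _
    exact TStructure.t.zero f b c (by simpa using h)
  | succ p ih =>
    intro L c hL h
    obtain ⟨T, rfl, S⟩ := exists_step L c hL
    rw [eq_bot_iff]
    intro f hf
    obtain ⟨g, hg, rfl⟩ := S.fil_succ K p hf
    rw [ih _ _ S.ge (by push_cast at h; lia)] at hg
    rw [AddSubgroup.mem_bot] at hg ⊢
    rw [hg, zero_comp]


/-! ### Subquotients -/

lemma subq_of_maps {G B S : Type*} [AddCommGroup G] [AddCommGroup B] [AddCommGroup S]
    (α : G →+ B) (β : G →+ S) (hβ : Function.Surjective β) (h : ∀ x, α x = 0 → β x = 0) :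
    IsAddSubquotient B S := by
  have hk : ∀ x y, α x = α y → β x = β y := fun x y hxy => by
    have := h (x - y) (by rw [map_sub, hxy, sub_self])
    rwa [map_sub, sub_eq_zero] at this
  choose s hs using fun b : α.range => b.2
  refine ⟨α.range, AddMonoidHom.mk' (fun b => β (s b)) ?_, ?_⟩
  · intro a b
    rw [← map_add]
    apply hk
    rw [hs, map_add, hs, hs]
    rfl
  · intro t
    obtain ⟨x, rfl⟩ := hβ t
    exact ⟨⟨α x, x, rfl⟩, hk _ _ (hs _)⟩

lemma subq_trans {B B' S S' : Type*} [AddCommGroup B] [AddCommGroup B'] [AddCommGroup S]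
    [AddCommGroup S'] (h : IsAddSubquotient B S) (i : B →+ B') (hi : Function.Injective i)
    (q : S →+ S') (hq : Function.Surjective q) : IsAddSubquotient B' S' := by
  obtain ⟨C, π, hπ⟩ := h
  refine subq_of_maps (i.comp C.subtype) (q.comp π) (hq.comp hπ) ?_
  intro x hx
  have : x = 0 := Subtype.ext (hi (by simpa using hx))
  simp [this]

/-- The graded pieces of the ghost filtration. -/
abbrev Gr (K L : DerivedCategory A) (p : ℕ) := filtGradedPiece (fun q => Fil K q L) p

/-- The map on graded pieces induced by the ghost map of a step. -/
noncomputable def Step.gr (S : Step T c) (K : DerivedCategory A) (p : ℕ) :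
    Gr K T.obj₁ p →+ Gr K T.obj₂ (p + 1) :=
  QuotientAddGroup.map _ _
    (((Preadditive.rightComp K T.mor₁).comp (Fil K p T.obj₁).subtype).codRestrict
      (Fil K (p + 1) T.obj₂) (fun f => Fil.comp_ghost S.ge f.2 S.ghost))
    (fun _ hf => Fil.comp_ghost (p := p + 1) S.ge hf S.ghost)

lemma Step.gr_surjective (S : Step T c) (K : DerivedCategory A) (p : ℕ) :
    Function.Surjective (S.gr K p) := by
  intro x
  obtain ⟨⟨f, hf⟩, rfl⟩ := QuotientAddGroup.mk_surjective x
  obtain ⟨g, hg, rfl⟩ := S.fil_succ K p hf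
  exact ⟨QuotientAddGroup.mk ⟨g, hg⟩, rfl⟩

variable [HasExt.{w} A]

/-- The product of Ext groups, with flexible indexing. -/
abbrev EProd (K L : DerivedCategory A) (p : ℕ) :=
  ∀ s : {q : ℤ × ℤ // q.2 + p = q.1},
    Ext.{w} ((homologyFunctor A s.1.1).obj K) ((homologyFunctor A s.1.2).obj L) p

lemma subq_zero (K L : DerivedCategory A) (c : ℤ) (hK : K.IsGE c) :
    IsAddSubquotient (EProd K L 0) (Gr K L 0) := by
  let α : Fil K 0 L →+ EProd K L 0 := AddMonoidHom.mk' (fun f ⟨(n, m), h⟩ =>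
      Ext.mk₀ ((homologyFunctor A n).map f.1 ≫ eqToHom (by
        obtain rfl : m = n := by simpa using h
        rfl))) (by
      intro f g
      funext ⟨⟨n, m⟩, h⟩
      simp [Ext.mk₀_add])
  refine subq_of_maps α (QuotientAddGroup.mk' _) (QuotientAddGroup.mk'_surjective _) ?_
  intro f hf
  simp only [QuotientAddGroup.mk'_apply]
  rw [QuotientAddGroup.eq_zero_iff, AddSubgroup.mem_addSubgroupOf]
  apply Fil.mem_of_ghost hK
  intro n
  have h := congr_fun hf ⟨(n, n), by simp⟩
  change Ext.mk₀ ((homologyFunctor A n).map f.1 ≫ 𝟙 _) = 0 at h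
  rwa [Category.comp_id, Ext.mk₀_eq_zero_iff] at h

/-- The connecting maps on Ext groups. -/
noncomputable def Step.conn (S : Step T c) (K : DerivedCategory A) (p : ℕ) :
    EProd K T.obj₁ p →+ EProd K T.obj₂ (p + 1) :=
  AddMonoidHom.mk' (fun x ⟨(n, m), h⟩ =>
    (x ⟨(n, m + 1), by push_cast at h ⊢; lia⟩).comp (S.ses_shortExact m).extClass rfl) (by
    intro x y
    funext ⟨⟨n, m⟩, h⟩
    exact Ext.add_comp _ _ _ _)

lemma Step.conn_injective (S : Step T c) (K : DerivedCategory A) (p : ℕ) :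
    Function.Injective (S.conn K (p + 1)) := by
  rw [injective_iff_map_eq_zero]
  intro x hx
  funext ⟨⟨n, m⟩, h⟩
  obtain ⟨m, rfl⟩ : ∃ m', m = m' + 1 := ⟨m - 1, by lia⟩
  have h0 := congr_fun hx ⟨(n, m), by push_cast at h ⊢; lia⟩
  obtain ⟨y, hy⟩ := Ext.covariant_sequence_exact₃ _ (S.ses_shortExact m) (x ⟨(n, m + 1), h⟩) rfl h0
  have : Injective (S.ses m).X₂ := S.inj m
  rw [Ext.eq_zero_of_injective y, Ext.zero_comp] at hy
  exact hy.symm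

lemma subq_one (S : Step T c) (K : DerivedCategory A) (a : ℤ) (hK : K.IsGE a) :
    IsAddSubquotient (EProd K T.obj₂ 1) (Gr K T.obj₂ 1) := by
  let α : Fil K 0 T.obj₁ →+ EProd K T.obj₂ 1 := AddMonoidHom.mk' (fun f ⟨(n, m), h⟩ =>
      (Ext.mk₀ ((homologyFunctor A n).map f.1 ≫ eqToHom (by
        obtain rfl : m + 1 = n := by simpa using h
        rfl))).comp (S.ses_shortExact m).extClass (zero_add 1)) (by
      intro f g
      funext ⟨⟨n, m⟩, h⟩
      simp only [AddSubgroup.coe_add, Functor.map_add, Preadditive.add_comp, Ext.mk₀_add,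
        Ext.add_comp]
      rfl)
  refine subq_of_maps α ((S.gr K 0).comp (QuotientAddGroup.mk' _))
    ((S.gr_surjective K 0).comp (QuotientAddGroup.mk'_surjective _)) ?_
  rintro ⟨f, hf⟩ h0
  have h1 : ∀ m : ℤ, ∃ φ : (homologyFunctor A (m + 1)).obj K ⟶ (homologyFunctor A m).obj T.obj₃,
      φ ≫ HomologySequence.δ T m (m + 1) rfl = (homologyFunctor A (m + 1)).map f := by
    intro m
    have h := congr_fun h0 ⟨(m + 1, m), by simp⟩
    change (Ext.mk₀ ((homologyFunctor A (m + 1)).map f ≫ 𝟙 _)).comp (S.ses_shortExact m).extClass (zero_add 1) = 0 at h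
    rw [Category.comp_id] at h
    obtain ⟨y, hy⟩ := Ext.covariant_sequence_exact₃ _ (S.ses_shortExact m) _ _ h
    obtain ⟨φ, rfl⟩ := Ext.mk₀_bijective _ _ |>.2 y
    refine ⟨φ, (Ext.mk₀_bijective _ _).1 ?_⟩
    rw [← hy, Ext.mk₀_comp_mk₀]
    rfl
  choose φ hφ using h1
  obtain ⟨ψ, hψ⟩ := S.ex (K⟦(1 : ℤ)⟧) (fun m =>
    ((homologyFunctor A 0).shiftIso 1 m (m + 1) (add_comm _ _)).hom.app K ≫ φ m)
  obtain ⟨g, hg⟩ := (shiftFunctor (DerivedCategory A) (1 : ℤ)).map_surjective (ψ ≫ T.mor₃)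
  have hgf : ∀ m, (homologyFunctor A (m + 1)).map g = (homologyFunctor A (m + 1)).map f := by
    intro m
    rw [← hφ m]
    have h2 := ((homologyFunctor A 0).shiftIso 1 m (m + 1) (add_comm _ _)).hom.naturality g
    have h3 : (homologyFunctor A m).map ((shiftFunctor (DerivedCategory A) (1 : ℤ)).map g) ≫
        ((homologyFunctor A 0).shiftIso 1 m (m + 1) (add_comm _ _)).hom.app T.obj₁ =
        ((homologyFunctor A 0).shiftIso 1 m (m + 1) (add_comm _ _)).hom.app K ≫
        φ m ≫ HomologySequence.δ T m (m + 1) rfl := by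
      rw [hg, Functor.map_comp, hψ]
      exact (Category.assoc _ _ _).trans (Category.assoc _ _ _)
    exact (cancel_epi
      (((homologyFunctor A 0).shiftIso 1 m (m + 1) (add_comm _ _)).hom.app K)).1 (h2.symm.trans h3)
  have hg0 : g ≫ T.mor₁ = 0 := by
    apply (shiftFunctor (DerivedCategory A) (1 : ℤ)).map_injective
    rw [Functor.map_comp, hg, Category.assoc, comp_distTriang_mor_zero₃₁ _ S.dist]
    simp
  have hgh : Ghost (f - g) := by
    intro n
    obtain ⟨m, rfl⟩ : ∃ m', n = m' + 1 := ⟨n - 1, by lia⟩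
    rw [Functor.map_sub, hgf, sub_self]
  change (QuotientAddGroup.mk (⟨f ≫ T.mor₁, _⟩ : Fil K 1 T.obj₂) : Gr K T.obj₂ 1) = 0
  rw [QuotientAddGroup.eq_zero_iff, AddSubgroup.mem_addSubgroupOf]
  change f ≫ T.mor₁ ∈ Fil K 2 T.obj₂
  have : f ≫ T.mor₁ = (f - g) ≫ T.mor₁ := by rw [Preadditive.sub_comp, hg0, sub_zero]
  rw [this]
  exact Fil.comp_ghost (p := 1) S.ge (Fil.mem_of_ghost hK hgh) S.ghost

lemma subq_all [EnoughInjectives A] (K : DerivedCategory A) (a : ℤ) (hK : K.IsGE a) (p : ℕ) :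
    ∀ (L : DerivedCategory A) (c : ℤ), L.IsGE c → IsAddSubquotient (EProd K L p) (Gr K L p) := by
  induction p with
  | zero => exact fun L _ _ => subq_zero K L a hK
  | succ p ih =>
    intro L c hL
    obtain ⟨T, rfl, S⟩ := exists_step L c hL
    cases p with
    | zero => exact subq_one S K a hK
    | succ p =>
      exact subq_trans (ih _ _ S.ge) (S.conn K (p + 1)) (S.conn_injective K p)
        (S.gr K (p + 1)) (S.gr_surjective K (p + 1))

/-- Comparison with the product of Hom groups in the derived category. -/
noncomputable def EProd.toExtProd (K L : DerivedCategory A) (p : ℕ) :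
    EProd K L p →+ extProdGrp A K L p :=
  AddMonoidHom.mk' (fun x n => Ext.homAddEquiv (x ⟨(n, n - p), by simp⟩)) (by
    intro x y
    funext n
    simp)

lemma EProd.toExtProd_injective (K L : DerivedCategory A) (p : ℕ) :
    Function.Injective (EProd.toExtProd K L p) := by
  intro x y h
  funext ⟨⟨n, m⟩, hm⟩
  obtain rfl : m = n - p := by lia
  exact Ext.homAddEquiv.injective (congr_fun h n)

end Filtration

end ObsFil

/-- **Proposition.** Let `A` be an abelian category with enough injectives.  Then the
Hom-groups of the bounded derived category `D^b(A)` carry a natural decreasing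
multiplicative filtration with `F⁰ = Hom`, `F^p = 0` for `p ≫ 0`, `F¹` the morphisms
vanishing on all cohomology objects, and `F^p/F^{p+1}` a subquotient of
`∏ₙ Ext^p(Hⁿ(K), H^{n-p}(L))`. -/
theorem exists_obstruction_filtration (A : Type u') [Category.{v'} A] [Abelian A]
    [EnoughInjectives A] [HasDerivedCategory.{w} A] :
    ∃ F : ∀ (K L : DerivedCategory A), ℕ → AddSubgroup (K ⟶ L),
      IsObstructionFiltration A F := by
  have := hasExt_of_hasDerivedCategory A
  have hge : ∀ K : DerivedCategory A, isBddD A K → ∃ c, K.IsGE c := by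
    rintro K ⟨a, b, h⟩
    exact ⟨a, (DerivedCategory.isGE_iff K a).2 fun i hi => h i (Or.inl hi)⟩
  have hle : ∀ K : DerivedCategory A, isBddD A K → ∃ c, K.IsLE c := by
    rintro K ⟨a, b, h⟩
    exact ⟨b, (DerivedCategory.isLE_iff K b).2 fun i hi => h i (Or.inr hi)⟩
  refine ⟨fun K L p => ObsFil.Fil K p L, ?_, ?_, ?_, ?_, ?_⟩
  · intro K' K L L' _ _ _ _ u v p f hf
    exact ObsFil.Fil.comp_left u (ObsFil.Fil.comp_right hf v)
  · intro K L hK hL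
    obtain ⟨b, hb⟩ := hle K hK
    obtain ⟨c, hc⟩ := hge L hL
    refine ⟨ObsFil.Fil.anti K L, by simp [ObsFil.Fil], (b - c + 1).toNat, fun p hp => ?_⟩
    exact ObsFil.Fil.eq_bot K b hb p L c hc (by lia)
  · intro K L M _ _ _ p q f g hf hg
    exact ObsFil.Fil.mul hf hg
  · intro K L hK hL p
    obtain ⟨a, ha⟩ := hge K hK
    obtain ⟨c, hc⟩ := hge L hL
    exact ObsFil.subq_trans (ObsFil.subq_all K a ha p L c hc) _
      (ObsFil.EProd.toExtProd_injective K L p) (AddMonoidHom.id _) Function.surjective_id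
  · intro K L hK _ f
    obtain ⟨a, ha⟩ := hge K hK
    exact ⟨ObsFil.Fil.ghost_of_mem, fun h => ObsFil.Fil.mem_of_ghost ha h⟩
end

section
/- Let T be a triangulated category, S a set of objects of T, and let K_0 → K_1 → ⋯ → K_m be a sequence of morphisms in T such that for each 0 ≤ i ≤ m−1 the cone of K_i → K_{i+1} lies in ⟨S⟩_1. Then for each 1 ≤ i ≤ m the cone of the composition K_0 → K_i lies in ⟨S⟩_i. Consequently, if in addition the composition K_0 → K_m is the zero morphism, then K_0 ∈ ⟨S⟩_m. -/
/-!
STATEMENT 14: a form of the converse ghost lemma.  If the cone of each `K i ⟶ K (i+1)`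
lies in `⟨S⟩₁`, then the cone of `K 0 ⟶ K i` lies in `⟨S⟩ᵢ`; consequently if the
composition `K 0 ⟶ K m` is zero then `K 0 ∈ ⟨S⟩ₘ`.
-/

open CategoryTheory Limits Pretriangulated

universe v u

variable {C : Type u} [Category.{v} C] [Preadditive C] [HasZeroObject C]
  [HasShift C ℤ] [∀ n : ℤ, (shiftFunctor C n).Additive] [Pretriangulated C]

/-- The smallest class of objects of a triangulated category containing `S` which is
stable under isomorphisms, shifts, finite direct sums and direct summands. -/
inductive thickClosure (S : Set C) : C → Prop
  | of (X : C) (hX : X ∈ S) : thickClosure S X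
  | zero (X : C) (hX : IsZero X) : thickClosure S X
  | shift (X : C) (n : ℤ) (hX : thickClosure S X) : thickClosure S (X⟦n⟧)
  | sum (X Y Z : C) (i₁ : X ⟶ Z) (i₂ : Y ⟶ Z) (p₁ : Z ⟶ X) (p₂ : Z ⟶ Y)
      (hi₁ : i₁ ≫ p₁ = 𝟙 X) (hi₂ : i₂ ≫ p₂ = 𝟙 Y) (h : p₁ ≫ i₁ + p₂ ≫ i₂ = 𝟙 Z)
      (hX : thickClosure S X) (hY : thickClosure S Y) : thickClosure S Z
  | retract (X Y : C) (i : X ⟶ Y) (r : Y ⟶ X) (hir : i ≫ r = 𝟙 X)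
      (hY : thickClosure S Y) : thickClosure S X

/-- The objects `E` admitting a distinguished triangle `A ⟶ E ⟶ B ⟶ A⟦1⟧` with
`A ∈ S₁` and `B ∈ S₂`. -/
def extensions (S₁ S₂ : Set C) : Set C :=
  {E | ∃ (A B : C) (f : A ⟶ E) (g : E ⟶ B) (h : B ⟶ A⟦(1 : ℤ)⟧),
    (Triangle.mk f g h ∈ distTriang C) ∧ A ∈ S₁ ∧ B ∈ S₂}

/-- `genSubcat S n` is the subcategory `⟨S⟩ₙ` generated by `S` in `n` steps
(i.e. using at most `n - 1` cones). -/
def genSubcat (S : Set C) : ℕ → Set C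
  | 0 => setOf (thickClosure (∅ : Set C))
  | (n + 1) => setOf (thickClosure (extensions (genSubcat S n) (setOf (thickClosure S))))

/-- The composition `K 0 ⟶ K m` of a chain of morphisms `K i ⟶ K (i+1)`. -/
def compChain {T : Type*} [Category T] (K : ℕ → T) (f : ∀ i, K i ⟶ K (i + 1)) :
    ∀ m, K 0 ⟶ K m
  | 0 => 𝟙 _
  | (m + 1) => compChain K f m ≫ f m

/-- Restatements of exactness for explicit triangles. -/
lemma lift_mor₁ {X Y Z W : C} {f : X ⟶ Y} {g : Y ⟶ Z} {h : Z ⟶ X⟦(1 : ℤ)⟧}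
    (H : Triangle.mk f g h ∈ distTriang C) (k : W ⟶ Y) (hk : k ≫ g = 0) :
    ∃ l : W ⟶ X, k = l ≫ f :=
  Triangle.coyoneda_exact₂ _ H k hk

lemma lift_mor₂ {X Y Z W : C} {f : X ⟶ Y} {g : Y ⟶ Z} {h : Z ⟶ X⟦(1 : ℤ)⟧}
    (H : Triangle.mk f g h ∈ distTriang C) (k : W ⟶ Z) (hk : k ≫ h = 0) :
    ∃ l : W ⟶ Y, k = l ≫ g :=
  Triangle.coyoneda_exact₃ _ H k hk

lemma lift_mor₃ {X Y Z W : C} {f : X ⟶ Y} {g : Y ⟶ Z} {h : Z ⟶ X⟦(1 : ℤ)⟧}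
    (H : Triangle.mk f g h ∈ distTriang C) (k : W ⟶ X⟦(1 : ℤ)⟧) (hk : k ≫ f⟦(1 : ℤ)⟧' = 0) :
    ∃ l : W ⟶ Z, k = l ≫ h :=
  Triangle.coyoneda_exact₁ _ H k hk

lemma desc_mor₂ {X Y Z W : C} {f : X ⟶ Y} {g : Y ⟶ Z} {h : Z ⟶ X⟦(1 : ℤ)⟧}
    (H : Triangle.mk f g h ∈ distTriang C) (k : Y ⟶ W) (hk : f ≫ k = 0) :
    ∃ l : Z ⟶ W, k = g ≫ l :=
  Triangle.yoneda_exact₂ _ H k hk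

lemma desc_mor₁ {X Y Z W : C} {f : X ⟶ Y} {g : Y ⟶ Z} {h : Z ⟶ X⟦(1 : ℤ)⟧}
    (H : Triangle.mk f g h ∈ distTriang C) (k : X ⟶ W) (hk : h ≫ k⟦(1 : ℤ)⟧' = 0) :
    ∃ l : Y ⟶ W, k = f ≫ l := by
  obtain ⟨l, hl⟩ : ∃ l : Y⟦(1 : ℤ)⟧ ⟶ W⟦(1 : ℤ)⟧, k⟦(1 : ℤ)⟧' = (-f⟦(1 : ℤ)⟧') ≫ l :=
    Triangle.yoneda_exact₃ _ (rot_of_distTriang _ H) (k⟦(1 : ℤ)⟧') hk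
  refine ⟨-(shiftFunctor C (1 : ℤ)).preimage l, ?_⟩
  apply (shiftFunctor C (1 : ℤ)).map_injective
  rw [hl, Functor.map_comp, Functor.map_neg, Functor.map_preimage, Preadditive.neg_comp,
    Preadditive.comp_neg]

/-- A replacement of the octahedral axiom (which is not available for a general pretriangulated
category): the cone `E` of a composition `u ≫ v` is a direct summand of `Q ⊞ Q`, where `Q` is an
extension of the cone of `v` by the cone of `u`. -/
lemma cone_comp_retract {X Y Z A D E : C} {u : X ⟶ Y} {π : Y ⟶ A} {ι : A ⟶ X⟦(1 : ℤ)⟧}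
    (h₁ : Triangle.mk u π ι ∈ distTriang C)
    {v : Y ⟶ Z} {ψ : Z ⟶ D} {p : D ⟶ Y⟦(1 : ℤ)⟧} (h₂ : Triangle.mk v ψ p ∈ distTriang C)
    {α : Z ⟶ E} {δ : E ⟶ X⟦(1 : ℤ)⟧} (h₃ : Triangle.mk (u ≫ v) α δ ∈ distTriang C) :
    ∃ (Q : C) (j : A ⟶ Q) (q : Q ⟶ D) (k : D ⟶ A⟦(1 : ℤ)⟧),
      (Triangle.mk j q k ∈ distTriang C) ∧
      ∃ (s₁ s₂ : E ⟶ Q) (r₁ r₂ : Q ⟶ E), s₁ ≫ r₁ + s₂ ≫ r₂ = 𝟙 E := by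
  obtain ⟨Q, j, q, hQ⟩ := distinguished_cocone_triangle₂ (p ≫ π⟦(1 : ℤ)⟧')
  have uπ : u ≫ π = 0 := comp_distTriang_mor_zero₁₂ _ h₁
  have uπ1 : u⟦(1 : ℤ)⟧' ≫ π⟦(1 : ℤ)⟧' = 0 := by rw [← Functor.map_comp, uπ, Functor.map_zero]
  have pv : p ≫ v⟦(1 : ℤ)⟧' = 0 := comp_distTriang_mor_zero₃₁ _ h₂
  have uvα : (u ≫ v) ≫ α = 0 := comp_distTriang_mor_zero₁₂ _ h₃
  have δuv : δ ≫ (u ≫ v)⟦(1 : ℤ)⟧' = 0 := comp_distTriang_mor_zero₃₁ _ h₃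
  have αδ : α ≫ δ = 0 := comp_distTriang_mor_zero₂₃ _ h₃
  have jq : j ≫ q = 0 := comp_distTriang_mor_zero₁₂ _ hQ
  refine ⟨Q, j, q, _, hQ, ?_⟩
  -- first endomorphism
  obtain ⟨s, r, hsr⟩ : ∃ (s : E ⟶ Q) (r : Q ⟶ E), s ≫ r ≫ δ = δ := by
    have h₁' : Triangle.mk ι (-u⟦(1 : ℤ)⟧') (-π⟦(1 : ℤ)⟧') ∈ distTriang C :=
      rot_of_distTriang _ (rot_of_distTriang _ h₁)
    obtain ⟨ρ, hρ₁, hρ₂⟩ : ∃ ρ : Q ⟶ X⟦(1 : ℤ)⟧, j ≫ ρ = 𝟙 A ≫ ι ∧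
        q ≫ (-p) = ρ ≫ (-u⟦(1 : ℤ)⟧') :=
      complete_distinguished_triangle_morphism₂ _ _ hQ h₁' (𝟙 A) (-p) (by
        change (p ≫ π⟦(1 : ℤ)⟧') ≫ (𝟙 A)⟦(1 : ℤ)⟧' = (-p) ≫ (-π⟦(1 : ℤ)⟧')
        rw [CategoryTheory.Functor.map_id, Category.comp_id, Preadditive.neg_comp_neg])
    rw [Category.id_comp] at hρ₁
    rw [Preadditive.comp_neg, Preadditive.comp_neg, neg_inj] at hρ₂
    obtain ⟨r, hr⟩ := lift_mor₃ h₃ ρ (by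
      rw [Functor.map_comp, ← Category.assoc, ← hρ₂, Category.assoc, pv, comp_zero])
    obtain ⟨w, hw⟩ := lift_mor₃ h₂ (δ ≫ u⟦(1 : ℤ)⟧') (by
      rw [Category.assoc, ← Functor.map_comp, δuv])
    obtain ⟨s, hs⟩ := lift_mor₂ hQ w (by
      rw [← Category.assoc, ← hw, Category.assoc, uπ1, comp_zero])
    obtain ⟨t, ht⟩ := lift_mor₃ h₁ (s ≫ ρ - δ) (by
      rw [Preadditive.sub_comp, Category.assoc, ← hρ₂, ← Category.assoc, ← hs, ← hw, sub_self])
    refine ⟨s - t ≫ j, r, ?_⟩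
    rw [← hr, Preadditive.sub_comp, Category.assoc, hρ₁, ← ht, sub_sub_cancel]
  -- second endomorphism
  obtain ⟨s', r', hsr'⟩ : ∃ (s : E ⟶ Q) (r : Q ⟶ E), α ≫ s ≫ r = α := by
    obtain ⟨η, hη₁, hη₂⟩ : ∃ η : Z ⟶ Q, v ≫ η = π ≫ j ∧ ψ ≫ 𝟙 D = η ≫ q :=
      complete_distinguished_triangle_morphism₂ _ _ h₂ hQ π (𝟙 D) (by
        change p ≫ π⟦(1 : ℤ)⟧' = 𝟙 D ≫ p ≫ π⟦(1 : ℤ)⟧'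
        rw [Category.id_comp])
    rw [Category.comp_id] at hη₂
    obtain ⟨s, hs⟩ := desc_mor₂ h₃ η (by
      rw [Category.assoc, hη₁, ← Category.assoc, uπ, zero_comp])
    obtain ⟨c, hc⟩ := desc_mor₂ h₁ (v ≫ α) (by rw [← Category.assoc, uvα])
    obtain ⟨r, hr⟩ := desc_mor₁ hQ c (by
      rw [Category.assoc, ← Functor.map_comp, ← hc, Functor.map_comp, ← Category.assoc, pv,
        zero_comp])
    obtain ⟨t, ht⟩ := desc_mor₂ h₂ (η ≫ r - α) (by
      rw [Preadditive.comp_sub, ← Category.assoc, hη₁, Category.assoc, ← hr, ← hc, sub_self])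
    refine ⟨s, r - q ≫ t, ?_⟩
    rw [← Category.assoc, ← hs, Preadditive.comp_sub, ← Category.assoc, ← hη₂, ← ht,
      sub_sub_cancel]
  obtain ⟨z, hz⟩ := lift_mor₂ h₃ (𝟙 E - s ≫ r) (by
    rw [Preadditive.sub_comp, Category.id_comp, Category.assoc, hsr, sub_self])
  refine ⟨s, (𝟙 E - s ≫ r) ≫ s', r, r', ?_⟩
  rw [hz, Category.assoc, Category.assoc, hsr', ← hz, add_sub_cancel]

lemma thickClosure_idem {S S' : Set C} (h : ∀ X ∈ S, thickClosure S' X) {X : C}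
    (hX : thickClosure S X) : thickClosure S' X := by
  induction hX with
  | of X hX => exact h X hX
  | zero X hX => exact .zero X hX
  | shift X n _ ih => exact .shift X n ih
  | sum X Y Z i₁ i₂ p₁ p₂ hi₁ hi₂ h _ _ ihX ihY =>
    exact .sum X Y Z i₁ i₂ p₁ p₂ hi₁ hi₂ h ihX ihY
  | retract X Y i r hir _ ih => exact .retract X Y i r hir ih

lemma isZero_of_thickClosure_empty {X : C} (hX : thickClosure (∅ : Set C) X) : IsZero X := by
  induction hX with
  | of X hX => exact hX.elim
  | zero X hX => exact hX
  | shift X n _ ih => exact (shiftFunctor C n).map_isZero ih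
  | sum X Y Z i₁ i₂ p₁ p₂ hi₁ hi₂ h _ _ ihX ihY =>
    rw [IsZero.iff_id_eq_zero, ← h, ihX.eq_of_tgt p₁ 0, ihY.eq_of_tgt p₂ 0]
    simp
  | retract X Y i r hir _ ih =>
    rw [IsZero.iff_id_eq_zero, ← hir, ih.eq_of_tgt i 0, zero_comp]

lemma thickClosure_of_genSubcat_one {S : Set C} {X : C} (hX : X ∈ genSubcat S 1) :
    thickClosure S X := by
  refine thickClosure_idem ?_ hX
  rintro E ⟨A, B, f, g, h, H, hA, hB⟩
  have hA' : IsZero A := isZero_of_thickClosure_empty hA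
  obtain ⟨r, hr⟩ := desc_mor₂ H (𝟙 E) (hA'.eq_of_src _ _)
  exact .retract E B g r hr.symm hB

lemma cone_compChain_mem (S : Set C) (m : ℕ) (K : ℕ → C)
    (f : ∀ i, K i ⟶ K (i + 1))
    (hcone : ∀ i < m, ∃ (B : C) (g : K (i + 1) ⟶ B) (h : B ⟶ (K i)⟦(1 : ℤ)⟧),
      (Triangle.mk (f i) g h ∈ distTriang C) ∧ B ∈ genSubcat S 1) (i : ℕ) (hi : i ≤ m) :
    ∀ (B : C) (g : K i ⟶ B) (h : B ⟶ (K 0)⟦(1 : ℤ)⟧),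
      (Triangle.mk (compChain K f i) g h ∈ distTriang C) → B ∈ genSubcat S i := by
  induction i with
  | zero =>
    intro B g h H
    exact .zero B (Triangle.isZero₃_of_isIso₁ _ H (inferInstanceAs (IsIso (𝟙 (K 0)))))
  | succ i ih =>
    intro E α δ H
    obtain ⟨A, π, ι, h₁⟩ := distinguished_cocone_triangle (compChain K f i)
    obtain ⟨D, ψ, p, h₂, hD⟩ := hcone i hi
    have hA := ih (by omega) A π ι h₁
    obtain ⟨Q, j, q, k, hQ, s₁, s₂, r₁, r₂, hsr⟩ := cone_comp_retract h₁ h₂ H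
    have hQ' : thickClosure (extensions (genSubcat S i) (setOf (thickClosure S))) Q :=
      .of Q ⟨A, D, j, q, k, hQ, hA, thickClosure_of_genSubcat_one hD⟩
    refine .retract E (Q ⊞ Q) (biprod.lift s₁ s₂) (biprod.desc r₁ r₂) (by simpa using hsr) ?_
    exact .sum Q Q (Q ⊞ Q) biprod.inl biprod.inr biprod.fst biprod.snd (by simp) (by simp)
      biprod.total hQ' hQ'

lemma genSubcat_of_shift {S : Set C} {n : ℕ} {X : C} (h : X⟦(1 : ℤ)⟧ ∈ genSubcat S n) :
    X ∈ genSubcat S n := by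
  have key : ∀ S' : Set C, thickClosure S' (X⟦(1 : ℤ)⟧) → thickClosure S' X := fun S' h' =>
    .retract X _ ((shiftShiftNeg X (1 : ℤ)).inv) ((shiftShiftNeg X (1 : ℤ)).hom)
      (Iso.inv_hom_id _) (.shift _ (-1) h')
  cases n with
  | zero => exact key _ h
  | succ n => exact key _ h

lemma genSubcat_retract {S : Set C} {n : ℕ} {X Y : C} (i : X ⟶ Y) (r : Y ⟶ X)
    (hir : i ≫ r = 𝟙 X) (h : Y ∈ genSubcat S n) : X ∈ genSubcat S n := by
  cases n with
  | zero => exact .retract X Y i r hir h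
  | succ n => exact .retract X Y i r hir h

/-- **Converse ghost lemma.** Let `K 0 ⟶ K 1 ⟶ ⋯ ⟶ K m` be a sequence of morphisms in a
triangulated category such that the cone of each `K i ⟶ K (i+1)` (`i < m`) lies in `⟨S⟩₁`.
Then for `1 ≤ i ≤ m` every cone of the composition `K 0 ⟶ K i` lies in `⟨S⟩ᵢ`; and if
moreover the composition `K 0 ⟶ K m` is zero, then `K 0 ∈ ⟨S⟩ₘ`. -/
theorem converse_ghost_lemma (S : Set C) (m : ℕ) (K : ℕ → C)
    (f : ∀ i, K i ⟶ K (i + 1))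
    (hcone : ∀ i < m, ∃ (B : C) (g : K (i + 1) ⟶ B) (h : B ⟶ (K i)⟦(1 : ℤ)⟧),
      (Triangle.mk (f i) g h ∈ distTriang C) ∧ B ∈ genSubcat S 1) :
    (∀ i, 1 ≤ i → i ≤ m →
      ∀ (B : C) (g : K i ⟶ B) (h : B ⟶ (K 0)⟦(1 : ℤ)⟧),
        (Triangle.mk (compChain K f i) g h ∈ distTriang C) → B ∈ genSubcat S i) ∧
    (compChain K f m = 0 → K 0 ∈ genSubcat S m) := by
  refine ⟨fun i _ hi => cone_compChain_mem S m K f hcone i hi, fun h0 => ?_⟩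
  obtain ⟨E, α, δ, H⟩ := distinguished_cocone_triangle (compChain K f m)
  obtain ⟨l, hl⟩ := lift_mor₃ H (𝟙 ((K 0)⟦(1 : ℤ)⟧)) (by
    rw [h0, Functor.map_zero, comp_zero])
  exact genSubcat_of_shift
    (genSubcat_retract l δ hl.symm (cone_compChain_mem S m K f hcone m le_rfl E α δ H))
end
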